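/- Let r : ℝ → ℝ be smooth, 2π-periodic (r(x+2π) = r(x) for all x), and positive (r(x) > 0 for all x). Then ∫_{−π}^{π} [ √(1+r'(x)^2)·G(r)(x) + (r(x)r'(x)/√(1+r'(x)^2))·(G(r))'(x) ] dx = − ∫_{−π}^{π} (r(x)/√(1+r'(x)^2))·((H(r))'(x))^2 dx. In particular, the left-hand side (the first variation of the surface area functional S(r) = ∫_{−π}^{π} r√(1+r'^2) dx in the direction G(r)) is nonpositive. -/

import Mathlib

open Real

/-- The (normalized) mean curvature of the surface of revolution with profile `r`. -/
noncomputable def meanCurv (r : ℝ → ℝ) (x : ℝ) : ℝ :=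
  1 / (r x * Real.sqrt (1 + (deriv r x) ^ 2)) -
    deriv (deriv r) x / (1 + (deriv r x) ^ 2) ^ ((3 : ℝ) / 2)

/-- The axisymmetric surface diffusion operator
`G(r)(x) = (1/r) ∂ₓ [ (r/√(1+r'²)) ∂ₓ H(r) ](x)`. -/
noncomputable def asdG (r : ℝ → ℝ) (x : ℝ) : ℝ :=
  (1 / r x) *
    deriv (fun y => r y / Real.sqrt (1 + (deriv r y) ^ 2) * deriv (meanCurv r) y) x

theorem Function.Periodic.deriv_real {f : ℝ → ℝ} {c : ℝ} (hf : Function.Periodic f c) :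
    Function.Periodic (deriv f) c := by
  intro x
  rw [← deriv_comp_add_const, funext hf]

theorem ContDiff.deriv_smooth {f : ℝ → ℝ} (hf : ContDiff ℝ (⊤ : ℕ∞) f) :
    ContDiff ℝ (⊤ : ℕ∞) (deriv f) :=
  (contDiff_infty_iff_deriv.mp hf).2

theorem contDiff_sqrt_one_add_deriv_sq {r : ℝ → ℝ} (hr : ContDiff ℝ (⊤ : ℕ∞) r) :
    ContDiff ℝ (⊤ : ℕ∞) (fun x => Real.sqrt (1 + (deriv r x) ^ 2)) :=
  (contDiff_const.add (hr.deriv_smooth.pow 2)).sqrt fun x => by positivity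

theorem one_add_sq_rpow_three_halves (p : ℝ) :
    (1 + p ^ 2) ^ ((3 : ℝ) / 2) = Real.sqrt (1 + p ^ 2) ^ 3 := by
  rw [Real.sqrt_eq_rpow, ← Real.rpow_mul_natCast (by positivity)]
  norm_num

theorem meanCurv_eq (r : ℝ → ℝ) :
    meanCurv r = fun x => 1 / (r x * Real.sqrt (1 + (deriv r x) ^ 2)) -
      deriv (deriv r) x / Real.sqrt (1 + (deriv r x) ^ 2) ^ 3 := by
  funext x
  rw [meanCurv, one_add_sq_rpow_three_halves]

theorem contDiff_meanCurv {r : ℝ → ℝ} (hr : ContDiff ℝ (⊤ : ℕ∞) r) (hpos : ∀ x, 0 < r x) :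
    ContDiff ℝ (⊤ : ℕ∞) (meanCurv r) := by
  have hq := contDiff_sqrt_one_add_deriv_sq hr
  rw [meanCurv_eq]
  refine (contDiff_const.div (hr.mul hq) fun x => ?_).sub
    (hr.deriv_smooth.deriv_smooth.div (hq.pow 3) fun x => ?_)
  · have := hpos x
    positivity
  · positivity

theorem contDiff_flux {r : ℝ → ℝ} (hr : ContDiff ℝ (⊤ : ℕ∞) r) (hpos : ∀ x, 0 < r x) :
    ContDiff ℝ (⊤ : ℕ∞)
      (fun y => r y / Real.sqrt (1 + (deriv r y) ^ 2) * deriv (meanCurv r) y) :=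
  (hr.div (contDiff_sqrt_one_add_deriv_sq hr) fun x => by positivity).mul
    (contDiff_meanCurv hr hpos).deriv_smooth

theorem contDiff_asdG {r : ℝ → ℝ} (hr : ContDiff ℝ (⊤ : ℕ∞) r) (hpos : ∀ x, 0 < r x) :
    ContDiff ℝ (⊤ : ℕ∞) (asdG r) :=
  (contDiff_const.div hr fun x => (hpos x).ne').mul (contDiff_flux hr hpos).deriv_smooth

theorem periodic_meanCurv {r : ℝ → ℝ} {c : ℝ} (hper : Function.Periodic r c) :
    Function.Periodic (meanCurv r) c := fun x => by
  simp only [meanCurv, hper x, hper.deriv_real x, hper.deriv_real.deriv_real x]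

theorem periodic_flux {r : ℝ → ℝ} {c : ℝ} (hper : Function.Periodic r c) :
    Function.Periodic
      (fun y => r y / Real.sqrt (1 + (deriv r y) ^ 2) * deriv (meanCurv r) y) c := fun x => by
  simp only [hper x, hper.deriv_real x, (periodic_meanCurv hper).deriv_real x]

theorem periodic_asdG {r : ℝ → ℝ} {c : ℝ} (hper : Function.Periodic r c) :
    Function.Periodic (asdG r) c := fun x => by
  simp only [asdG, hper x, (periodic_flux hper).deriv_real x]

/-- The derivative of `r r' / √(1+r'²)` is `√(1+r'²) - r H(r)`. -/
theorem hasDerivAt_mul_deriv_div_sqrt {r : ℝ → ℝ} (hr : ContDiff ℝ (⊤ : ℕ∞) r)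
    (hpos : ∀ x, 0 < r x) (x : ℝ) :
    HasDerivAt (fun y => r y * deriv r y / Real.sqrt (1 + (deriv r y) ^ 2))
      (Real.sqrt (1 + (deriv r x) ^ 2) - r x * meanCurv r x) x := by
  have h0 : HasDerivAt r (deriv r x) x := (hr.differentiable (by simp) x).hasDerivAt
  have h1 : HasDerivAt (deriv r) (deriv (deriv r) x) x :=
    (hr.deriv_smooth.differentiable (by simp) x).hasDerivAt
  have hq := ((h1.pow 2).const_add 1).sqrt (by simp only [Pi.pow_apply]; positivity)
  have hq0 : 0 < Real.sqrt (1 + (deriv r x) ^ 2) := by positivity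
  have hsq : Real.sqrt (1 + (deriv r x) ^ 2) ^ 2 = 1 + (deriv r x) ^ 2 :=
    Real.sq_sqrt (by positivity)
  have hrx := (hpos x).ne'
  refine ((h0.mul h1).div hq hq0.ne').congr_deriv ?_
  rw [meanCurv_eq]
  simp only [Pi.pow_apply, Pi.mul_apply]
  generalize Real.sqrt (1 + (deriv r x) ^ 2) = q at *
  generalize deriv (deriv r) x = s at *
  generalize deriv r x = p at *
  have hp : p ^ 2 = q ^ 2 - 1 := by linarith
  field_simp
  norm_num
  linear_combination 2 * (q ^ 2 - r x * s) * hp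

/-- The first-variation integrand plus the dissipation density is an exact derivative. -/
theorem hasDerivAt_first_variation_primitive {r : ℝ → ℝ} (hr : ContDiff ℝ (⊤ : ℕ∞) r)
    (hpos : ∀ x, 0 < r x) (x : ℝ) :
    HasDerivAt
      (fun y => r y * deriv r y / Real.sqrt (1 + (deriv r y) ^ 2) * asdG r y +
        meanCurv r y * (r y / Real.sqrt (1 + (deriv r y) ^ 2) * deriv (meanCurv r) y))
      ((Real.sqrt (1 + (deriv r x) ^ 2) * asdG r x +
          r x * deriv r x / Real.sqrt (1 + (deriv r x) ^ 2) * deriv (asdG r) x) +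
        r x / Real.sqrt (1 + (deriv r x) ^ 2) * (deriv (meanCurv r) x) ^ 2) x := by
  have hG := ((contDiff_asdG hr hpos).differentiable (by simp) x).hasDerivAt
  have hH := ((contDiff_meanCurv hr hpos).differentiable (by simp) x).hasDerivAt
  have hV := ((contDiff_flux hr hpos).differentiable (by simp) x).hasDerivAt
  have hVG : deriv (fun y => r y / Real.sqrt (1 + (deriv r y) ^ 2) * deriv (meanCurv r) y) x =
      r x * asdG r x := by
    rw [asdG, ← mul_assoc, mul_one_div_cancel (hpos x).ne', one_mul]
  rw [hVG] at hV
  refine (((hasDerivAt_mul_deriv_div_sqrt hr hpos x).mul hG).add (hH.mul hV)).congr_deriv ?_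
  ring

/-- The first variation of the surface area functional `S(r) = ∫ r √(1+r'²)` in the
direction `G(r)` equals `-∫ (r/√(1+r'²)) (H(r)')² dx`; in particular it is nonpositive. -/
theorem first_variation_area_in_direction_asdG (r : ℝ → ℝ)
    (hr : ContDiff ℝ (⊤ : ℕ∞) r)
    (hper : ∀ x, r (x + 2 * Real.pi) = r x)
    (hpos : ∀ x, 0 < r x) :
    (∫ x in (-Real.pi)..Real.pi,
        (Real.sqrt (1 + (deriv r x) ^ 2) * asdG r x +
          r x * deriv r x / Real.sqrt (1 + (deriv r x) ^ 2) * deriv (asdG r) x)) =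
      -∫ x in (-Real.pi)..Real.pi,
          r x / Real.sqrt (1 + (deriv r x) ^ 2) * (deriv (meanCurv r) x) ^ 2 ∧
    (∫ x in (-Real.pi)..Real.pi,
        (Real.sqrt (1 + (deriv r x) ^ 2) * asdG r x +
          r x * deriv r x / Real.sqrt (1 + (deriv r x) ^ 2) * deriv (asdG r) x)) ≤ 0 := by
  have hq := contDiff_sqrt_one_add_deriv_sq hr
  have hq0 : ∀ x, Real.sqrt (1 + (deriv r x) ^ 2) ≠ 0 := fun x => by positivity
  have hGs := contDiff_asdG hr hpos
  have hcI : Continuous fun x => Real.sqrt (1 + (deriv r x) ^ 2) * asdG r x +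
      r x * deriv r x / Real.sqrt (1 + (deriv r x) ^ 2) * deriv (asdG r) x :=
    (hq.continuous.mul hGs.continuous).add
      (((hr.continuous.mul hr.deriv_smooth.continuous).div hq.continuous hq0).mul
        hGs.deriv_smooth.continuous)
  have hcD : Continuous fun x =>
      r x / Real.sqrt (1 + (deriv r x) ^ 2) * (deriv (meanCurv r) x) ^ 2 :=
    (hr.continuous.div hq.continuous hq0).mul
      ((contDiff_meanCurv hr hpos).deriv_smooth.continuous.pow 2)
  have hper' : Function.Periodic r (2 * Real.pi) := hper
  have hsum := intervalIntegral.integral_eq_sub_of_hasDerivAt (a := -Real.pi) (b := Real.pi)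
    (fun x _ => hasDerivAt_first_variation_primitive hr hpos x)
    ((hcI.add hcD).intervalIntegrable _ _)
  have hpi : Real.pi = -Real.pi + 2 * Real.pi := by ring
  have hend : ∀ f : ℝ → ℝ, Function.Periodic f (2 * Real.pi) → f Real.pi = f (-Real.pi) :=
    fun f hf => by simpa only [← hpi] using hf (-Real.pi)
  rw [intervalIntegral.integral_add (hcI.intervalIntegrable _ _) (hcD.intervalIntegrable _ _),
    hend r hper', hend _ hper'.deriv_real, hend _ (periodic_asdG hper'),
    hend _ (periodic_meanCurv hper'), hend _ (periodic_meanCurv hper').deriv_real, sub_self] at hsum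
  have heq := eq_neg_of_add_eq_zero_left hsum
  refine ⟨heq, heq.trans_le (neg_nonpos.mpr ?_)⟩
  refine intervalIntegral.integral_nonneg (by linarith [Real.pi_pos]) fun x _ => ?_
  have := hpos x
  positivity
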